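/- arXiv:hep-th/9404040 — 4 statements merged into one kernel-verified Lean document; each statement's English description precedes it below -/
import Mathlib

section
/- Let L and A_(1), …, A_(p) be N×N matrices over A and R an N²×N² matrix over A such that {L ⊗, L} = [R, L ⊗ 1] − [R^π, 1 ⊗ L], {L ⊗, A_(i)} = −[R^π, 1 ⊗ A_(i)] for all i, and {A_(i) ⊗, A_(j)} = 0 (entrywise) for all i, j. Then the traces of arbitrary words in the matrices L, A_(1), …, A_(p) have pairwise vanishing brackets: for any two finite products M_1 ⋯ M_s and M′_1 ⋯ M′_t with each factor taken from {L, A_(1), …, A_(p)}, one has {Tr(M_1 ⋯ M_s), Tr(M′_1 ⋯ M′_t)} = 0. -/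
open Matrix Kronecker

structure PoissonBr (A : Type*) [CommRing A] where
  br : A → A → A
  add_left : ∀ x y z, br (x + y) z = br x z + br y z
  add_right : ∀ x y z, br x (y + z) = br x y + br x z
  antisymm : ∀ x y, br x y = -br y x
  leibniz : ∀ x y z, br x (y * z) = br x y * z + y * br x z

/-- The matrix `{M ⊗, M'}` of pairwise brackets of entries. -/
def matBr {A : Type*} [CommRing A] {N : ℕ} (P : PoissonBr A)
    (M M' : Matrix (Fin N) (Fin N) A) :
    Matrix (Fin N × Fin N) (Fin N × Fin N) A :=
  fun p q => P.br (M p.1 q.1) (M' p.2 q.2)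

/-- `R^π`, the permuted matrix. -/
def piSwap {A : Type*} [CommRing A] {N : ℕ}
    (R : Matrix (Fin N × Fin N) (Fin N × Fin N) A) :
    Matrix (Fin N × Fin N) (Fin N × Fin N) A :=
  fun p q => R (p.2, p.1) (q.2, q.1)

/-- The Casimir matrix `C`, with entries `C_{(i,k),(j,l)} = δ_{il} δ_{kj}`. -/
def casC {A : Type*} [CommRing A] {N : ℕ} :
    Matrix (Fin N × Fin N) (Fin N × Fin N) A :=
  fun p q => if p.1 = q.2 ∧ p.2 = q.1 then 1 else 0

/-- Matrix commutator. -/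
def mComm {A : Type*} [CommRing A] {n : Type*} [Fintype n] (X Y : Matrix n n A) :
    Matrix n n A := X * Y - Y * X

namespace PoissonBr

variable {A : Type*} [CommRing A] (P : PoissonBr A)

/-- The bracket with its first argument fixed, as an additive map. -/
def brRight (x : A) : A →+ A := AddMonoidHom.mk' (P.br x) (P.add_right x)

/-- The bracket with its second argument fixed, as an additive map. -/
def brLeft (y : A) : A →+ A := AddMonoidHom.mk' (fun x => P.br x y) (fun a b => P.add_left a b y)

theorem br_zero_right (x : A) : P.br x 0 = 0 := (P.brRight x).map_zero

theorem br_zero_left (y : A) : P.br 0 y = 0 := (P.brLeft y).map_zero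

theorem br_one_right (x : A) : P.br x 1 = 0 := by
  simpa using P.leibniz x 1 1

theorem br_one_left (y : A) : P.br 1 y = 0 := by
  rw [P.antisymm, br_one_right, neg_zero]

theorem br_sum_right {ι : Type*} (s : Finset ι) (x : A) (f : ι → A) :
    P.br x (∑ i ∈ s, f i) = ∑ i ∈ s, P.br x (f i) :=
  map_sum (P.brRight x) f s

theorem br_sum_left {ι : Type*} (s : Finset ι) (f : ι → A) (y : A) :
    P.br (∑ i ∈ s, f i) y = ∑ i ∈ s, P.br (f i) y :=
  map_sum (P.brLeft y) f s

theorem leibniz_left (x y z : A) : P.br (x * y) z = P.br x z * y + x * P.br y z := by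
  rw [P.antisymm, P.leibniz, P.antisymm z x, P.antisymm z y]
  ring

end PoissonBr

section MatrixBracket

variable {A : Type*} [CommRing A] {N : ℕ} (P : PoissonBr A)

theorem kronecker_one_mul_apply (X : Matrix (Fin N) (Fin N) A)
    (Y : Matrix (Fin N × Fin N) (Fin N × Fin N) A) (a b : Fin N × Fin N) :
    ((X ⊗ₖ (1 : Matrix (Fin N) (Fin N) A)) * Y) a b = ∑ j, X a.1 j * Y (j, a.2) b := by
  simp [Matrix.mul_apply, Fintype.sum_prod_type, Matrix.kroneckerMap_apply, Matrix.one_apply]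

theorem one_kronecker_mul_apply (X : Matrix (Fin N) (Fin N) A)
    (Y : Matrix (Fin N × Fin N) (Fin N × Fin N) A) (a b : Fin N × Fin N) :
    (((1 : Matrix (Fin N) (Fin N) A) ⊗ₖ X) * Y) a b = ∑ j, X a.2 j * Y (a.1, j) b := by
  simp [Matrix.mul_apply, Fintype.sum_prod_type_right, Matrix.kroneckerMap_apply, Matrix.one_apply]

theorem mul_kronecker_one_apply (X : Matrix (Fin N) (Fin N) A)
    (Y : Matrix (Fin N × Fin N) (Fin N × Fin N) A) (a b : Fin N × Fin N) :
    (Y * (X ⊗ₖ (1 : Matrix (Fin N) (Fin N) A))) a b = ∑ j, Y a (j, b.2) * X j b.1 := by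
  simp [Matrix.mul_apply, Fintype.sum_prod_type, Matrix.kroneckerMap_apply, Matrix.one_apply]

theorem mul_one_kronecker_apply (X : Matrix (Fin N) (Fin N) A)
    (Y : Matrix (Fin N × Fin N) (Fin N × Fin N) A) (a b : Fin N × Fin N) :
    (Y * ((1 : Matrix (Fin N) (Fin N) A) ⊗ₖ X)) a b = ∑ j, Y a (b.1, j) * X j b.2 := by
  simp [Matrix.mul_apply, Fintype.sum_prod_type_right, Matrix.kroneckerMap_apply, Matrix.one_apply]

theorem mul_kronecker_one (X Y : Matrix (Fin N) (Fin N) A) :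
    (X * Y) ⊗ₖ (1 : Matrix (Fin N) (Fin N) A) = (X ⊗ₖ 1) * (Y ⊗ₖ 1) := by
  rw [← Matrix.mul_kronecker_mul, one_mul]

theorem one_kronecker_mul (X Y : Matrix (Fin N) (Fin N) A) :
    (1 : Matrix (Fin N) (Fin N) A) ⊗ₖ (X * Y) = (1 ⊗ₖ X) * (1 ⊗ₖ Y) := by
  rw [← Matrix.mul_kronecker_mul, one_mul]

theorem kronecker_one_commute_one_kronecker (X Y : Matrix (Fin N) (Fin N) A) :
    (X ⊗ₖ (1 : Matrix (Fin N) (Fin N) A)) * (1 ⊗ₖ Y) = (1 ⊗ₖ Y) * (X ⊗ₖ 1) := by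
  simp [← Matrix.mul_kronecker_mul]

theorem matBr_mul_left (X Y Z : Matrix (Fin N) (Fin N) A) :
    matBr P (X * Y) Z = matBr P X Z * (Y ⊗ₖ 1) + (X ⊗ₖ 1) * matBr P Y Z := by
  ext a b
  simp only [Matrix.add_apply, mul_kronecker_one_apply, kronecker_one_mul_apply, matBr,
    Matrix.mul_apply (M := X) (N := Y), P.br_sum_left, P.leibniz_left, Finset.sum_add_distrib]

theorem matBr_mul_right (X Y Z : Matrix (Fin N) (Fin N) A) :
    matBr P X (Y * Z) = matBr P X Y * (1 ⊗ₖ Z) + (1 ⊗ₖ Y) * matBr P X Z := by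
  ext a b
  simp only [Matrix.add_apply, mul_one_kronecker_apply, one_kronecker_mul_apply, matBr,
    Matrix.mul_apply (M := Y) (N := Z), P.br_sum_right, P.leibniz, Finset.sum_add_distrib]

theorem matBr_one_left (X : Matrix (Fin N) (Fin N) A) : matBr P 1 X = 0 := by
  ext a b
  simp only [matBr, Matrix.one_apply, Matrix.zero_apply]
  split_ifs <;> simp [P.br_one_left, P.br_zero_left]

theorem matBr_one_right (X : Matrix (Fin N) (Fin N) A) : matBr P X 1 = 0 := by
  ext a b
  simp only [matBr, Matrix.one_apply, Matrix.zero_apply]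
  split_ifs <;> simp [P.br_one_right, P.br_zero_right]

theorem trace_matBr (X Y : Matrix (Fin N) (Fin N) A) :
    (matBr P X Y).trace = P.br X.trace Y.trace := by
  simp only [Matrix.trace, Matrix.diag, matBr, Fintype.sum_prod_type, P.br_sum_left,
    P.br_sum_right]

theorem trace_mComm {n : Type*} [Fintype n] (X Y : Matrix n n A) : (mComm X Y).trace = 0 := by
  rw [mComm, Matrix.trace_sub, Matrix.trace_mul_comm, sub_self]

theorem matBr_swap (X Y : Matrix (Fin N) (Fin N) A) :
    matBr P Y X = -piSwap (matBr P X Y) := by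
  ext a b
  exact P.antisymm _ _

theorem piSwap_mComm_piSwap_one_kronecker (R : Matrix (Fin N × Fin N) (Fin N × Fin N) A)
    (X : Matrix (Fin N) (Fin N) A) :
    piSwap (mComm (piSwap R) (1 ⊗ₖ X)) = mComm R (X ⊗ₖ 1) := by
  ext a b
  simp only [mComm, piSwap, Matrix.sub_apply, one_kronecker_mul_apply, mul_one_kronecker_apply,
    kronecker_one_mul_apply, mul_kronecker_one_apply]

theorem exists_matBr_prod_left {ι : Type*} {m : ι → Matrix (Fin N) (Fin N) A}
    {S T : ι → Matrix (Fin N × Fin N) (Fin N × Fin N) A}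
    (h : ∀ a b, matBr P (m a) (m b) = mComm (T b) (m a ⊗ₖ 1) - mComm (S a) (1 ⊗ₖ m b))
    (l : List ι) :
    ∃ S', ∀ b, matBr P (l.map m).prod (m b) =
      mComm (T b) ((l.map m).prod ⊗ₖ 1) - mComm S' (1 ⊗ₖ m b) := by
  induction l with
  | nil => exact ⟨0, fun b => by simp [matBr_one_left, mComm]⟩
  | cons a l ih =>
    obtain ⟨S', hS'⟩ := ih
    refine ⟨S a * ((l.map m).prod ⊗ₖ 1) + (m a ⊗ₖ 1) * S', fun b => ?_⟩
    rw [List.map_cons, List.prod_cons, matBr_mul_left, h, hS', mul_kronecker_one]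
    have h₁ := kronecker_one_commute_one_kronecker (m a) (m b)
    have h₂ := kronecker_one_commute_one_kronecker (l.map m).prod (m b)
    simp only [mComm, mul_sub, sub_mul, mul_add, add_mul, mul_assoc, h₂]
    simp only [← mul_assoc, h₁]
    abel

theorem exists_matBr_prod_right {ι : Type*} {m : ι → Matrix (Fin N) (Fin N) A}
    {X : Matrix (Fin N) (Fin N) A} {S : Matrix (Fin N × Fin N) (Fin N × Fin N) A}
    {T : ι → Matrix (Fin N × Fin N) (Fin N × Fin N) A}
    (h : ∀ b, matBr P X (m b) = mComm (T b) (X ⊗ₖ 1) - mComm S (1 ⊗ₖ m b))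
    (l : List ι) :
    ∃ T', matBr P X (l.map m).prod = mComm T' (X ⊗ₖ 1) - mComm S (1 ⊗ₖ (l.map m).prod) := by
  induction l with
  | nil => exact ⟨0, by simp [matBr_one_right, mComm]⟩
  | cons b l ih =>
    obtain ⟨T', hT'⟩ := ih
    refine ⟨T b * (1 ⊗ₖ (l.map m).prod) + (1 ⊗ₖ m b) * T', ?_⟩
    rw [List.map_cons, List.prod_cons, matBr_mul_right, h, hT', one_kronecker_mul]
    have h₁ := kronecker_one_commute_one_kronecker X (m b)
    have h₂ := kronecker_one_commute_one_kronecker X (l.map m).prod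
    simp only [mComm, mul_sub, sub_mul, mul_add, add_mul, mul_assoc, ← h₂]
    simp only [← mul_assoc, ← h₁]
    abel

theorem br_trace_prod_eq_zero {ι : Type*} {m : ι → Matrix (Fin N) (Fin N) A}
    {S T : ι → Matrix (Fin N × Fin N) (Fin N × Fin N) A}
    (h : ∀ a b, matBr P (m a) (m b) = mComm (T b) (m a ⊗ₖ 1) - mComm (S a) (1 ⊗ₖ m b))
    (l l' : List ι) :
    P.br (l.map m).prod.trace (l'.map m).prod.trace = 0 := by
  obtain ⟨S', hS'⟩ := exists_matBr_prod_left P h l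
  obtain ⟨T', hT'⟩ := exists_matBr_prod_right P hS' l'
  rw [← trace_matBr, hT', Matrix.trace_sub, trace_mComm, trace_mComm, sub_zero]

end MatrixBracket

theorem statement1 {A : Type*} [CommRing A] {N : ℕ} (P : PoissonBr A)
    (L : Matrix (Fin N) (Fin N) A) {p : ℕ}
    (Amat : Fin p → Matrix (Fin N) (Fin N) A)
    (R : Matrix (Fin N × Fin N) (Fin N × Fin N) A)
    (hLL : matBr P L L =
      mComm R (L ⊗ₖ (1 : Matrix (Fin N) (Fin N) A)) -
        mComm (piSwap R) ((1 : Matrix (Fin N) (Fin N) A) ⊗ₖ L))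
    (hLA : ∀ i, matBr P L (Amat i) =
      -mComm (piSwap R) ((1 : Matrix (Fin N) (Fin N) A) ⊗ₖ Amat i))
    (hAA : ∀ i j, matBr P (Amat i) (Amat j) = 0) :
    ∀ (s t : ℕ), 1 ≤ s → 1 ≤ t →
      ∀ (M : Fin s → Matrix (Fin N) (Fin N) A)
        (M' : Fin t → Matrix (Fin N) (Fin N) A),
        (∀ k, M k = L ∨ ∃ i, M k = Amat i) →
        (∀ k, M' k = L ∨ ∃ i, M' k = Amat i) →
        P.br ((List.ofFn M).prod).trace ((List.ofFn M').prod).trace = 0 := by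
  intro s t _ _ M M' hM hM'
  let m : Option (Fin p) → Matrix (Fin N) (Fin N) A := fun o => o.elim L Amat
  have letters : ∀ X, (X = L ∨ ∃ i, X = Amat i) → ∃ o, m o = X := by
    rintro X (rfl | ⟨i, rfl⟩)
    exacts [⟨none, rfl⟩, ⟨some i, rfl⟩]
  choose f hf using fun k => letters _ (hM k)
  choose g hg using fun k => letters _ (hM' k)
  obtain rfl : m ∘ f = M := funext hf
  obtain rfl : m ∘ g = M' := funext hg
  rw [← List.map_ofFn, ← List.map_ofFn]
  refine br_trace_prod_eq_zero P (S := fun o => o.elim (piSwap R) fun _ => 0)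
    (T := fun o => o.elim R fun _ => 0) ?_ _ _
  rintro (_ | i) (_ | j)
  · exact hLL
  · simpa [m, mComm] using hLA j
  · have h := matBr_swap P L (Amat i)
    rw [hLA] at h
    have hneg : -piSwap (-mComm (piSwap R) (1 ⊗ₖ Amat i)) =
        piSwap (mComm (piSwap R) (1 ⊗ₖ Amat i)) := by
      ext a b
      simp [piSwap]
    rw [hneg, piSwap_mComm_piSwap_one_kronecker] at h
    simpa [m, mComm] using h
  · simpa [m, mComm] using hAA i j
end

section
/- For every p, q ≥ 0 and every choice of N, r ≥ 1, there exists a polynomial P with rational coefficients in the variables X_α, X_{n,m} (n + m ≤ p + q) and Y^{ab}_{n,m} (1 ≤ a, b ≤ r, n + m ≤ p + q), such that: for every commutative ℚ-algebra A, every α ∈ A, all ξ_i^a, η_i^a ∈ A, and all N×N matrices L, Q over A satisfying [L, Q] = F − α·1, one has Tr(L^p Q^q F) = P, where X_α is evaluated at α, X_{n,m} at Tr(L^n Q^m), and Y^{ab}_{n,m} at Tr(L^n Q^m F̃^{ab}), with F̃^{ab} := F^{ab} − (δ_{ab}/r) F. -/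
open Matrix

/-- The rank-one matrices `F^{ab}` with entries `(F^{ab})_{ij} = ξ_i^b η_j^a`. -/
def Fab {A : Type*} [CommRing A] {N r : ℕ} (ξ η : Fin N → Fin r → A)
    (a b : Fin r) : Matrix (Fin N) (Fin N) A :=
  Matrix.of fun i j => ξ i b * η j a

/-- `F = Σ_a F^{aa}`. -/
def Fmat {A : Type*} [CommRing A] {N r : ℕ} (ξ η : Fin N → Fin r → A) :
    Matrix (Fin N) (Fin N) A :=
  ∑ a, Fab ξ η a a

/-- `F̃^{ab} = F^{ab} - (δ_{ab}/r) F`. -/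
def Ftab {A : Type*} [CommRing A] [Algebra ℚ A] {N r : ℕ}
    (ξ η : Fin N → Fin r → A) (a b : Fin r) : Matrix (Fin N) (Fin N) A :=
  Fab ξ η a b - (if a = b then ((r : ℚ)⁻¹) else 0) • Fmat ξ η

/-- Variables: `X_α`, `X_{n,m}` (`n+m ≤ p+q`), and `Y^{ab}_{n,m}` (`n+m ≤ p+q`). -/
def RatVars5 (r l : ℕ) : Type :=
  Unit ⊕ {nm : ℕ × ℕ // nm.1 + nm.2 ≤ l} ⊕
    ((Fin r × Fin r) × {nm : ℕ × ℕ // nm.1 + nm.2 ≤ l})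

section TraceReduction

variable {A : Type*} [CommRing A] {N r : ℕ}

theorem trace_mul_Fab (ξ η : Fin N → Fin r → A) (M : Matrix (Fin N) (Fin N) A) (a b : Fin r) :
    (M * Fab ξ η a b).trace = (η · a) ⬝ᵥ M *ᵥ (ξ · b) := by
  rw [show Fab ξ η a b = Matrix.vecMulVec (ξ · b) (η · a) from rfl, Matrix.mul_vecMulVec,
    Matrix.trace_vecMulVec, dotProduct_comm]

theorem trace_mul_Fab_mul_Fab (ξ η : Fin N → Fin r → A) (U V : Matrix (Fin N) (Fin N) A)
    (a b c d : Fin r) :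
    (U * Fab ξ η c d * V * Fab ξ η a b).trace =
      (U * Fab ξ η a d).trace * (V * Fab ξ η c b).trace := by
  simp only [trace_mul_Fab]
  rw [show Fab ξ η c d = Matrix.vecMulVec (ξ · d) (η · c) from rfl, Matrix.mul_vecMulVec,
    Matrix.vecMulVec_mul, Matrix.vecMulVec_mulVec, ← Matrix.dotProduct_mulVec]
  simp [dotProduct_smul, mul_comm]

/-- The product of the matrices spelled by a word, `true` standing for `L` and `false` for `Q`. -/
def wordProd (L Q : Matrix (Fin N) (Fin N) A) (w : List Bool) : Matrix (Fin N) (Fin N) A :=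
  (w.map fun x => if x then L else Q).prod

theorem wordProd_append (L Q : Matrix (Fin N) (Fin N) A) (u v : List Bool) :
    wordProd L Q (u ++ v) = wordProd L Q u * wordProd L Q v := by
  simp [wordProd]

theorem wordProd_cons (L Q : Matrix (Fin N) (Fin N) A) (x : Bool) (v : List Bool) :
    wordProd L Q (x :: v) = (if x then L else Q) * wordProd L Q v := by
  simp [wordProd]

theorem wordProd_replicate_true (L Q : Matrix (Fin N) (Fin N) A) (n : ℕ) :
    wordProd L Q (List.replicate n true) = L ^ n := by
  simp [wordProd]

theorem wordProd_replicate_false (L Q : Matrix (Fin N) (Fin N) A) (n : ℕ) :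
    wordProd L Q (List.replicate n false) = Q ^ n := by
  simp [wordProd]

variable [Algebra ℚ A] {S : Subalgebra ℚ A} {α : A} {ξ η : Fin N → Fin r → A}
  {L Q : Matrix (Fin N) (Fin N) A}

theorem trace_mul_comm_mul_Fab_mem (hα : α ∈ S)
    (hLQ : L * Q - Q * L = Fmat ξ η - α • (1 : Matrix (Fin N) (Fin N) A)) {d : ℕ}
    (ih : ∀ w : List Bool, w.length < d → ∀ a b, (wordProd L Q w * Fab ξ η a b).trace ∈ S)
    {u v : List Bool} (huv : u.length + v.length < d) (a b : Fin r) :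
    (wordProd L Q u * (L * Q - Q * L) * wordProd L Q v * Fab ξ η a b).trace ∈ S := by
  rw [hLQ]
  have hsplit : (wordProd L Q u * (Fmat ξ η - α • (1 : Matrix (Fin N) (Fin N) A)) *
        wordProd L Q v * Fab ξ η a b).trace =
      ∑ c, (wordProd L Q u * Fab ξ η a c).trace * (wordProd L Q v * Fab ξ η c b).trace -
        α * (wordProd L Q (u ++ v) * Fab ξ η a b).trace := by
    simp only [← trace_mul_Fab_mul_Fab]
    simp [Fmat, mul_sub, sub_mul, Finset.mul_sum, Finset.sum_mul, Matrix.trace_sum,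
      wordProd_append]
  rw [hsplit]
  exact S.sub_mem
    (S.sum_mem fun c _ => S.mul_mem (ih u (by omega) a c) (ih v (by omega) c b))
    (S.mul_mem hα (ih (u ++ v) (by simpa using huv) a b))

theorem trace_wordProd_sub_mem_of_perm (hα : α ∈ S)
    (hLQ : L * Q - Q * L = Fmat ξ η - α • (1 : Matrix (Fin N) (Fin N) A)) {d : ℕ}
    (ih : ∀ w : List Bool, w.length < d → ∀ a b, (wordProd L Q w * Fab ξ η a b).trace ∈ S)
    {w w' : List Bool} (h : w.Perm w') (a b : Fin r) :
    ∀ u : List Bool, u.length + w.length ≤ d →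
      (wordProd L Q (u ++ w) * Fab ξ η a b).trace -
        (wordProd L Q (u ++ w') * Fab ξ η a b).trace ∈ S := by
  induction h with
  | nil => simp
  | cons x _ hind =>
    intro u hu
    simpa using hind (u ++ [x]) (by simp at hu ⊢; omega)
  | swap x y l =>
    intro u hu
    have key := trace_mul_comm_mul_Fab_mem hα hLQ ih (u := u) (v := l)
      (by simp at hu; omega) a b
    have hdiff : (wordProd L Q (u ++ true :: false :: l) * Fab ξ η a b).trace -
        (wordProd L Q (u ++ false :: true :: l) * Fab ξ η a b).trace ∈ S := by
      convert key using 1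
      rw [← Matrix.trace_sub]
      simp only [wordProd_append, wordProd_cons, if_true, Bool.false_eq_true, if_false]
      congr 1
      noncomm_ring
    cases x <;> cases y
    · simp
    · exact hdiff
    · simpa using S.neg_mem hdiff
    · simp
  | trans h₁ _ hind₁ hind₂ =>
    intro u hu
    simpa using S.add_mem (hind₁ u hu) (hind₂ u (h₁.length_eq ▸ hu))

theorem trace_commutator_pow_sub_mem (hα : α ∈ S)
    (hLQ : L * Q - Q * L = Fmat ξ η - α • (1 : Matrix (Fin N) (Fin N) A)) {p q : ℕ}
    (ih : ∀ w : List Bool, w.length < p + q →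
      ∀ a b, (wordProd L Q w * Fab ξ η a b).trace ∈ S)
    (hX : (L ^ p * Q ^ q).trace ∈ S) (n : ℕ) :
    ∀ m, n + m = q + 1 →
      (L ^ p * (L * Q ^ n - Q ^ n * L) * Q ^ m).trace -
        (n : A) * (L ^ p * Q ^ q * Fmat ξ η).trace ∈ S := by
  induction n with
  | zero => simp
  | succ n hn =>
    intro m hm
    have hlast : (L ^ p * Q ^ n * Fmat ξ η * Q ^ m).trace -
        (L ^ p * Q ^ q * Fmat ξ η).trace ∈ S := by
      have hperm : (List.replicate m false ++ (List.replicate p true ++ List.replicate n false)).Perm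
          (List.replicate p true ++ List.replicate q false) := by
        rw [List.perm_iff_count]
        rintro (_ | _) <;> simp [List.count_replicate]
        omega
      rw [Matrix.trace_mul_comm _ (Q ^ m)]
      have hsum : (Q ^ m * (L ^ p * Q ^ n * Fmat ξ η)).trace - (L ^ p * Q ^ q * Fmat ξ η).trace =
          ∑ c, ((Q ^ m * (L ^ p * Q ^ n) * Fab ξ η c c).trace -
            (L ^ p * Q ^ q * Fab ξ η c c).trace) := by
        simp [Fmat, Finset.mul_sum, Matrix.trace_sum, mul_assoc]
      rw [hsum]
      refine S.sum_mem fun c _ => ?_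
      simpa [wordProd_append, wordProd_replicate_true, wordProd_replicate_false] using
        trace_wordProd_sub_mem_of_perm hα hLQ ih hperm c c [] (by simp; omega)
    have hstep : (L ^ p * (L * Q ^ (n + 1) - Q ^ (n + 1) * L) * Q ^ m).trace =
        (L ^ p * (L * Q ^ n - Q ^ n * L) * Q ^ (m + 1)).trace +
          ((L ^ p * Q ^ n * Fmat ξ η * Q ^ m).trace - α * (L ^ p * Q ^ q).trace) := by
      have hq : Q ^ q = Q ^ n * Q ^ m := by rw [← pow_add]; congr 1; omega
      have hpow : L ^ p * (L * Q ^ (n + 1) - Q ^ (n + 1) * L) * Q ^ m =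
          L ^ p * (L * Q ^ n - Q ^ n * L) * Q ^ (m + 1) +
            L ^ p * Q ^ n * (L * Q - Q * L) * Q ^ m := by
        rw [pow_succ, pow_succ']
        noncomm_ring
      rw [hpow, hLQ, hq]
      simp [mul_sub, sub_mul, mul_assoc]
    have := S.add_mem (S.add_mem (hn (m + 1) (by omega)) hlast) (S.neg_mem (S.mul_mem hα hX))
    convert this using 1
    rw [hstep]
    push_cast
    ring

theorem trace_pow_mul_pow_mul_Fmat_mem (hα : α ∈ S)
    (hLQ : L * Q - Q * L = Fmat ξ η - α • (1 : Matrix (Fin N) (Fin N) A)) {p q : ℕ}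
    (ih : ∀ w : List Bool, w.length < p + q →
      ∀ a b, (wordProd L Q w * Fab ξ η a b).trace ∈ S)
    (hX : (L ^ p * Q ^ q).trace ∈ S) :
    (L ^ p * Q ^ q * Fmat ξ η).trace ∈ S := by
  have hmem := trace_commutator_pow_sub_mem hα hLQ ih hX (q + 1) 0 rfl
  have hzero : (L ^ p * (L * Q ^ (q + 1) - Q ^ (q + 1) * L) * Q ^ 0).trace = 0 := by
    rw [pow_zero, mul_one, mul_sub, Matrix.trace_sub, ← mul_assoc, ← mul_assoc,
      Matrix.trace_mul_comm (L ^ p * Q ^ (q + 1)) L, ← mul_assoc, ← pow_succ, ← pow_succ',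
      sub_self]
  rw [hzero, zero_sub] at hmem
  have hsmul := S.smul_mem (S.neg_mem hmem) ((q + 1 : ℚ)⁻¹)
  rw [neg_neg, ← nsmul_eq_mul, ← Nat.cast_smul_eq_nsmul ℚ, smul_smul] at hsmul
  rwa [Nat.cast_succ, inv_mul_cancel₀ (by positivity), one_smul] at hsmul

theorem trace_wordProd_mul_Fab_mem (hα : α ∈ S)
    (hLQ : L * Q - Q * L = Fmat ξ η - α • (1 : Matrix (Fin N) (Fin N) A)) {l : ℕ}
    (hX : ∀ n m, n + m ≤ l → (L ^ n * Q ^ m).trace ∈ S)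
    (hY : ∀ a b n m, n + m ≤ l → (L ^ n * Q ^ m * Ftab ξ η a b).trace ∈ S)
    (d : ℕ) (hd : d ≤ l + 1) :
    ∀ w : List Bool, w.length < d → ∀ a b, (wordProd L Q w * Fab ξ η a b).trace ∈ S := by
  induction d with
  | zero => simp
  | succ d hind =>
    intro w hw a b
    have ih := hind (by omega)
    have hlen : w.count true + w.count false = w.length := by
      simp
    have hle : w.count true + w.count false ≤ d := by omega
    have hF := trace_pow_mul_pow_mul_Fmat_mem (p := w.count true) (q := w.count false) hα hLQ
      (fun w' hw' => ih w' (by omega)) (hX _ _ (by omega))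
    have hperm : w.Perm
        (List.replicate (w.count true) true ++ List.replicate (w.count false) false) := by
      rw [List.perm_iff_count]
      rintro (_ | _) <;> simp [List.count_replicate]
    have hdiff := trace_wordProd_sub_mem_of_perm hα hLQ ih hperm a b [] (by simp; omega)
    have hsorted : (L ^ w.count true * Q ^ w.count false * Fab ξ η a b).trace ∈ S := by
      have := S.add_mem (hY a b (w.count true) (w.count false) (by omega))
        (S.smul_mem hF (if a = b then ((r : ℚ)⁻¹) else 0))
      rwa [← Matrix.trace_smul, ← Matrix.trace_add, ← Matrix.mul_smul, ← mul_add, Ftab,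
        sub_add_cancel] at this
    have := S.add_mem hdiff hsorted
    simpa [wordProd_append, wordProd_replicate_true, wordProd_replicate_false] using this

theorem trace_mul_Fmat_mem (hα : α ∈ S)
    (hLQ : L * Q - Q * L = Fmat ξ η - α • (1 : Matrix (Fin N) (Fin N) A)) {p q : ℕ}
    (hX : ∀ n m, n + m ≤ p + q → (L ^ n * Q ^ m).trace ∈ S)
    (hY : ∀ a b n m, n + m ≤ p + q → (L ^ n * Q ^ m * Ftab ξ η a b).trace ∈ S) :
    (L ^ p * Q ^ q * Fmat ξ η).trace ∈ S :=
  trace_pow_mul_pow_mul_Fmat_mem hα hLQ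
    (trace_wordProd_mul_Fab_mem hα hLQ hX hY _ (Nat.le_succ _)) (hX p q le_rfl)

end TraceReduction

section Naturality

variable {A B : Type*} [CommRing A] [CommRing B] [Algebra ℚ A] [Algebra ℚ B] {N r : ℕ}

theorem mapMatrix_Fab (f : A →ₐ[ℚ] B) (ξ η : Fin N → Fin r → A) (a b : Fin r) :
    f.mapMatrix (Fab ξ η a b) = Fab (fun i c => f (ξ i c)) (fun i c => f (η i c)) a b := by
  ext i j
  simp [Fab]

theorem mapMatrix_Fmat (f : A →ₐ[ℚ] B) (ξ η : Fin N → Fin r → A) :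
    f.mapMatrix (Fmat ξ η) = Fmat (fun i c => f (ξ i c)) (fun i c => f (η i c)) := by
  simp only [Fmat, map_sum, mapMatrix_Fab]

theorem mapMatrix_Ftab (f : A →ₐ[ℚ] B) (ξ η : Fin N → Fin r → A) (a b : Fin r) :
    f.mapMatrix (Ftab ξ η a b) = Ftab (fun i c => f (ξ i c)) (fun i c => f (η i c)) a b := by
  simp only [Ftab, map_sub, map_smul, mapMatrix_Fab, mapMatrix_Fmat]

theorem algHom_trace (f : A →ₐ[ℚ] B) (M : Matrix (Fin N) (Fin N) A) :
    f M.trace = (f.mapMatrix M).trace := by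
  simp [Matrix.trace]

end Naturality

/-- A commutative `ℚ`-algebra together with matrices satisfying `[L, Q] = F - α • 1`. -/
structure CommutatorData (N r : ℕ) where
  /-- The coefficient algebra. -/
  A : Type
  [commRing : CommRing A]
  [algebra : Algebra ℚ A]
  α : A
  ξ : Fin N → Fin r → A
  η : Fin N → Fin r → A
  L : Matrix (Fin N) (Fin N) A
  Q : Matrix (Fin N) (Fin N) A
  commutator_eq : L * Q - Q * L = Fmat ξ η - α • (1 : Matrix (Fin N) (Fin N) A)

attribute [instance] CommutatorData.commRing CommutatorData.algebra

/-- The point at which a polynomial in the variables `RatVars5` is evaluated. -/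
def evalPoint {A : Type*} [CommRing A] [Algebra ℚ A] {N r : ℕ} (l : ℕ) (α : A)
    (ξ η : Fin N → Fin r → A) (L Q : Matrix (Fin N) (Fin N) A) : RatVars5 r l → A
  | Sum.inl _ => α
  | Sum.inr (Sum.inl nm) => (L ^ nm.1.1 * Q ^ nm.1.2).trace
  | Sum.inr (Sum.inr abnm) =>
      (L ^ abnm.2.1.1 * Q ^ abnm.2.1.2 * Ftab ξ η abnm.1.1 abnm.1.2).trace

theorem exists_aeval_evalPoint_eq {A : Type*} [CommRing A] [Algebra ℚ A] {N r : ℕ} (p q : ℕ)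
    (α : A) (ξ η : Fin N → Fin r → A) (L Q : Matrix (Fin N) (Fin N) A)
    (hLQ : L * Q - Q * L = Fmat ξ η - α • (1 : Matrix (Fin N) (Fin N) A)) :
    ∃ P : MvPolynomial (RatVars5 r (p + q)) ℚ,
      MvPolynomial.aeval (evalPoint (p + q) α ξ η L Q) P =
        (L ^ p * Q ^ q * Fmat ξ η).trace := by
  have hvar (v : RatVars5 r (p + q)) : evalPoint (p + q) α ξ η L Q v ∈
      (MvPolynomial.aeval (R := ℚ) (evalPoint (p + q) α ξ η L Q)).range :=
    ⟨MvPolynomial.X v, MvPolynomial.aeval_X _ v⟩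
  exact trace_mul_Fmat_mem (hvar (Sum.inl ())) hLQ
    (fun n m h => hvar (Sum.inr (Sum.inl ⟨(n, m), h⟩)))
    (fun a b n m h => hvar (Sum.inr (Sum.inr ((a, b), ⟨(n, m), h⟩))))

theorem algHom_evalPoint {A B : Type*} [CommRing A] [CommRing B] [Algebra ℚ A] [Algebra ℚ B]
    {N r : ℕ} (f : A →ₐ[ℚ] B) (l : ℕ) (α : A) (ξ η : Fin N → Fin r → A)
    (L Q : Matrix (Fin N) (Fin N) A) (v : RatVars5 r l) :
    f (evalPoint l α ξ η L Q v) =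
      evalPoint l (f α) (fun i c => f (ξ i c)) (fun i c => f (η i c))
        (f.mapMatrix L) (f.mapMatrix Q) v := by
  rcases v with _ | _ | _
  · rfl
  · simp only [evalPoint, algHom_trace, map_mul, map_pow]
  · simp only [evalPoint, algHom_trace, map_mul, map_pow, mapMatrix_Ftab]

theorem statement5 (p q : ℕ) (N r : ℕ) (hN : 1 ≤ N) (hr : 1 ≤ r) :
    ∃ P : MvPolynomial (RatVars5 r (p + q)) ℚ,
      ∀ (A : Type) (_ : CommRing A) (_ : Algebra ℚ A) (α : A)
        (ξ η : Fin N → Fin r → A) (L Q : Matrix (Fin N) (Fin N) A),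
        L * Q - Q * L = Fmat ξ η - α • (1 : Matrix (Fin N) (Fin N) A) →
        (L ^ p * Q ^ q * Fmat ξ η).trace =
          MvPolynomial.aeval
            (fun v : RatVars5 r (p + q) =>
              match v with
              | Sum.inl _ => α
              | Sum.inr (Sum.inl nm) => (L ^ nm.1.1 * Q ^ nm.1.2).trace
              | Sum.inr (Sum.inr abnm) =>
                  (L ^ abnm.2.1.1 * Q ^ abnm.2.1.2 *
                    Ftab ξ η abnm.1.1 abnm.1.2).trace) P := by
  let Λ := ∀ D : CommutatorData N r, D.A
  let α₀ : Λ := fun D => D.α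
  let ξ₀ : Fin N → Fin r → Λ := fun i c D => D.ξ i c
  let η₀ : Fin N → Fin r → Λ := fun i c D => D.η i c
  let L₀ : Matrix (Fin N) (Fin N) Λ := Matrix.of fun i j D => D.L i j
  let Q₀ : Matrix (Fin N) (Fin N) Λ := Matrix.of fun i j D => D.Q i j
  have h₀ : L₀ * Q₀ - Q₀ * L₀ = Fmat ξ₀ η₀ - α₀ • (1 : Matrix (Fin N) (Fin N) Λ) := by
    ext i j D
    let f : Λ →ₐ[ℚ] D.A := Pi.evalAlgHom ℚ (fun D : CommutatorData N r => D.A) D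
    have h : f.mapMatrix (L₀ * Q₀ - Q₀ * L₀) =
        f.mapMatrix (Fmat ξ₀ η₀ - α₀ • (1 : Matrix (Fin N) (Fin N) Λ)) := by
      rw [map_sub, map_mul, map_mul, map_sub, mapMatrix_Fmat]
      refine D.commutator_eq.trans (congrArg (Fmat D.ξ D.η - ·) ?_)
      rw [Matrix.smul_one_eq_diagonal, Matrix.smul_one_eq_diagonal, AlgHom.mapMatrix_apply,
        Matrix.diagonal_map (map_zero f)]
      rfl
    exact congrFun (congrFun h i) j
  obtain ⟨P, hP⟩ := exists_aeval_evalPoint_eq p q α₀ ξ₀ η₀ L₀ Q₀ h₀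
  refine ⟨P, fun A _ _ α ξ η L Q h => ?_⟩
  let f : Λ →ₐ[ℚ] A :=
    Pi.evalAlgHom ℚ (fun D : CommutatorData N r => D.A) ⟨A, α, ξ, η, L, Q, h⟩
  have hf := congrArg f hP
  rw [MvPolynomial.comp_aeval_apply, algHom_trace, map_mul, map_mul, map_pow, map_pow,
    mapMatrix_Fmat] at hf
  refine hf.symm.trans (congrArg (fun v => MvPolynomial.aeval v P) (funext fun v => ?_))
  rw [algHom_evalPoint]
  rcases v with _ | _ | _ <;> rfl
end

section
/- Suppose the N×N matrices L and F^{ab} (1 ≤ a,b ≤ r) over A satisfy, for some N²×N² matrix R over A: {L ⊗, L} = [R, L ⊗ 1] − [R^π, 1 ⊗ L] and {L ⊗, F^{ab}} = −[R^π, 1 ⊗ F^{ab}] for all a, b. Then for all n, m ≥ 0 and all a, b: {Tr(L^n), Tr(L^m)} = 0 and {Tr(L^n), Tr(L^m F^{ab})} = 0. (The quantities Tr(L^n) are the commuting rational ECM Hamiltonians and the Tr(L^m F^{ab}) are the conserved current-algebra generators.) -/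
open Matrix Kronecker

/-- The derivation `{x, ·}`. -/
def PoissonBr.hamiltonian {A : Type*} [CommRing A] (P : PoissonBr A) (x : A) :
    Derivation ℤ A A :=
  Derivation.mk' (AddMonoidHom.mk' (P.br x) (P.add_right x)).toIntLinearMap fun y z => by
    simp [P.leibniz, mul_comm, add_comm]

theorem PoissonBr.hamiltonian_apply {A : Type*} [CommRing A] (P : PoissonBr A) (x y : A) :
    P.hamiltonian x y = P.br x y := rfl

namespace Derivation

variable {A : Type*} [CommRing A] (D : Derivation ℤ A A)

theorem map_matrix_one {n : Type*} [DecidableEq n] : (1 : Matrix n n A).map D = 0 := by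
  ext i j
  by_cases h : i = j <;> simp [h]

variable {n : Type*} [Fintype n]

theorem map_matrix_mul (X Y : Matrix n n A) :
    (X * Y).map D = X.map D * Y + X * Y.map D := by
  ext i j
  simp [Matrix.mul_apply, ← Finset.sum_add_distrib, mul_comm, add_comm]

theorem trace_map_matrix (X : Matrix n n A) : (X.map D).trace = D X.trace := by
  simp [Matrix.trace]

theorem apply_trace_pow [DecidableEq n] (X : Matrix n n A) (k : ℕ) :
    D (X ^ k).trace = k * (X ^ (k - 1) * X.map D).trace := by
  have key : ∀ (k : ℕ) (Y : Matrix n n A), Commute Y X →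
      (Y * (X ^ k).map D).trace = k * (Y * X ^ (k - 1) * X.map D).trace := by
    intro k
    induction k with
    | zero => intro Y _; simp [map_matrix_one]
    | succ k ih =>
      intro Y hY
      have h1 : (Y * ((X ^ k).map D * X)).trace = (Y * X * (X ^ k).map D).trace := by
        rw [← Matrix.mul_assoc, Matrix.trace_mul_comm, ← Matrix.mul_assoc, hY.eq]
      rw [pow_succ, map_matrix_mul, Matrix.mul_add, Matrix.trace_add, h1,
        ih _ (hY.mul_left (Commute.refl X)), ← Matrix.mul_assoc]
      rcases k with _ | k
      · simp
      · simp only [Nat.add_sub_cancel]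
        rw [Matrix.mul_assoc Y X, ← pow_succ']
        push_cast
        ring
  rw [← trace_map_matrix]
  simpa using key k 1 (Commute.one_left X)

/-- If `D` acts on `X` as a commutator, it acts on all powers of `X` that way. -/
theorem map_matrix_pow_eq_mComm [DecidableEq n] {M X : Matrix n n A}
    (hX : X.map D = mComm M X) (k : ℕ) : (X ^ k).map D = mComm M (X ^ k) := by
  induction k with
  | zero => simp [map_matrix_one, mComm]
  | succ k ih =>
    rw [pow_succ, map_matrix_mul, ih, hX]
    simp only [mComm]
    noncomm_ring

theorem map_matrix_mul_eq_mComm {M X Y : Matrix n n A}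
    (hX : X.map D = mComm M X) (hY : Y.map D = mComm M Y) :
    (X * Y).map D = mComm M (X * Y) := by
  rw [map_matrix_mul, hX, hY]
  simp only [mComm]
  noncomm_ring

theorem apply_trace_eq_zero {M X : Matrix n n A} (hX : X.map D = mComm M X) :
    D X.trace = 0 := by
  rw [← trace_map_matrix, hX, mComm, Matrix.trace_sub, Matrix.trace_mul_comm, sub_self]

end Derivation

section PartialTrace

variable {A : Type*} [CommRing A] {N : ℕ}

/-- The block of `Z` obtained by fixing the indices of the second tensor factor. -/
def tensorBlock (Z : Matrix (Fin N × Fin N) (Fin N × Fin N) A) (k l : Fin N) :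
    Matrix (Fin N) (Fin N) A :=
  fun i j => Z (i, k) (j, l)

/-- The partial trace over the first tensor factor of `(X ⊗ 1) Z`. -/
def partialTrace (X : Matrix (Fin N) (Fin N) A)
    (Z : Matrix (Fin N × Fin N) (Fin N × Fin N) A) : Matrix (Fin N) (Fin N) A :=
  fun k l => (X * tensorBlock Z k l).trace

theorem partialTrace_sub (X : Matrix (Fin N) (Fin N) A)
    (Z W : Matrix (Fin N × Fin N) (Fin N × Fin N) A) :
    partialTrace X (Z - W) = partialTrace X Z - partialTrace X W := by
  ext k l
  have : tensorBlock (Z - W) k l = tensorBlock Z k l - tensorBlock W k l := rfl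
  simp [partialTrace, this, Matrix.mul_sub]

theorem partialTrace_neg (X : Matrix (Fin N) (Fin N) A)
    (Z : Matrix (Fin N × Fin N) (Fin N × Fin N) A) :
    partialTrace X (-Z) = -partialTrace X Z := by
  ext k l
  have : tensorBlock (-Z) k l = -tensorBlock Z k l := rfl
  simp [partialTrace, this]

theorem partialTrace_mComm_kronecker_one {X Y : Matrix (Fin N) (Fin N) A} (h : Commute X Y)
    (Z : Matrix (Fin N × Fin N) (Fin N × Fin N) A) :
    partialTrace X (mComm Z (Y ⊗ₖ (1 : Matrix (Fin N) (Fin N) A))) = 0 := by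
  ext k l
  have hb : tensorBlock (mComm Z (Y ⊗ₖ (1 : Matrix (Fin N) (Fin N) A))) k l =
      tensorBlock Z k l * Y - Y * tensorBlock Z k l := by
    ext i j
    simp [tensorBlock, mComm, Matrix.mul_apply, Fintype.sum_prod_type, Matrix.one_apply]
  rw [partialTrace, hb, Matrix.mul_sub, Matrix.trace_sub, ← Matrix.mul_assoc,
    ← Matrix.mul_assoc, Matrix.trace_mul_comm, ← Matrix.mul_assoc, h.eq, sub_self,
    Matrix.zero_apply]

theorem partialTrace_mComm_one_kronecker (X Y : Matrix (Fin N) (Fin N) A)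
    (Z : Matrix (Fin N × Fin N) (Fin N × Fin N) A) :
    partialTrace X (mComm Z ((1 : Matrix (Fin N) (Fin N) A) ⊗ₖ Y)) =
      mComm (partialTrace X Z) Y := by
  ext k l
  have hb : tensorBlock (mComm Z ((1 : Matrix (Fin N) (Fin N) A) ⊗ₖ Y)) k l =
      ∑ p, Y p l • tensorBlock Z k p - ∑ p, Y k p • tensorBlock Z p l := by
    ext i j
    simp [tensorBlock, mComm, Matrix.mul_apply, Fintype.sum_prod_type, Matrix.one_apply,
      Matrix.sum_apply, mul_comm]
  have hr : mComm (partialTrace X Z) Y k l =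
      ∑ p, partialTrace X Z k p * Y p l - ∑ p, Y k p * partialTrace X Z p l := rfl
  rw [hr, partialTrace, hb]
  simp [partialTrace, Matrix.mul_sub, Matrix.mul_sum, Matrix.trace_sum, mul_comm]

end PartialTrace

theorem PoissonBr.map_hamiltonian_trace_pow {A : Type*} [CommRing A] {N : ℕ} (P : PoissonBr A)
    (X Y : Matrix (Fin N) (Fin N) A) (n : ℕ) :
    Y.map (P.hamiltonian (X ^ n).trace) =
      (n : A) • partialTrace (X ^ (n - 1)) (matBr P X Y) := by
  ext k l
  have hmap : X.map (P.hamiltonian (Y k l)) = -tensorBlock (matBr P X Y) k l := by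
    ext i j
    exact P.antisymm _ _
  rw [Matrix.map_apply, hamiltonian_apply, P.antisymm, ← hamiltonian_apply,
    Derivation.apply_trace_pow, hmap]
  simp [partialTrace]

theorem statement8 {A : Type*} [CommRing A] {N : ℕ} (P : PoissonBr A)
    {r : ℕ} (hr : 1 ≤ r) (L : Matrix (Fin N) (Fin N) A)
    (F : Fin r → Fin r → Matrix (Fin N) (Fin N) A)
    (R : Matrix (Fin N × Fin N) (Fin N × Fin N) A)
    (hLL : matBr P L L =
      mComm R (L ⊗ₖ (1 : Matrix (Fin N) (Fin N) A)) -
        mComm (piSwap R) ((1 : Matrix (Fin N) (Fin N) A) ⊗ₖ L))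
    (hLF : ∀ a b, matBr P L (F a b) =
      -mComm (piSwap R) ((1 : Matrix (Fin N) (Fin N) A) ⊗ₖ F a b)) :
    ∀ (n m : ℕ) (a b : Fin r),
      P.br ((L ^ n).trace) ((L ^ m).trace) = 0 ∧
      P.br ((L ^ n).trace) ((L ^ m * F a b).trace) = 0 := by
  intro n m a b
  set D := P.hamiltonian (L ^ n).trace with hD
  set M := -((n : A) • partialTrace (L ^ (n - 1)) (piSwap R)) with hM
  have hcomm : Commute (L ^ (n - 1)) L := (Commute.refl L).pow_left _
  have hL : L.map D = mComm M L := by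
    rw [hD, P.map_hamiltonian_trace_pow, hLL, partialTrace_sub,
      partialTrace_mComm_kronecker_one hcomm, partialTrace_mComm_one_kronecker, hM]
    simp only [mComm, zero_sub, smul_neg, smul_sub, Matrix.neg_mul, Matrix.mul_neg,
      Matrix.smul_mul, Matrix.mul_smul]
    abel
  have hF : (F a b).map D = mComm M (F a b) := by
    rw [hD, P.map_hamiltonian_trace_pow, hLF, partialTrace_neg,
      partialTrace_mComm_one_kronecker, hM]
    simp only [mComm, smul_neg, smul_sub, Matrix.neg_mul, Matrix.mul_neg,
      Matrix.smul_mul, Matrix.mul_smul]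
    abel
  have hpow := D.map_matrix_pow_eq_mComm hL m
  exact ⟨D.apply_trace_eq_zero hpow,
    D.apply_trace_eq_zero (D.map_matrix_mul_eq_mComm hpow hF)⟩
end

section
/- Suppose the N×N matrices L and Q over A satisfy, for some N²×N² matrix R over A: {L ⊗, L} = [R, L ⊗ 1] − [R^π, 1 ⊗ L], {L ⊗, Q} = −[R^π, 1 ⊗ Q] + C, and {Q ⊗, Q} = 0. Define W_n^m = Tr(L^n Q^m). Then for all n, m ≥ 1 one has exactly (with no reordering terms): {W_n^0, W_0^m} = n·m·W_{n−1}^{m−1}. -/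
open Matrix Kronecker

/-- Bracketing with a fixed element on the left, as a derivation. -/
def PoissonBr.leftDerivation {A : Type*} [CommRing A] (P : PoissonBr A) (x : A) :
    Derivation ℤ A A :=
  Derivation.mk' (AddMonoidHom.mk' (P.br x) (P.add_right x)).toIntLinearMap fun y z => by
    simp [P.leibniz, add_comm, mul_comm]

/-- Bracketing with a fixed element on the right, as a derivation. -/
def PoissonBr.rightDerivation {A : Type*} [CommRing A] (P : PoissonBr A) (y : A) :
    Derivation ℤ A A :=
  -P.leftDerivation y

theorem PoissonBr.leftDerivation_apply {A : Type*} [CommRing A] (P : PoissonBr A) (x y : A) :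
    P.leftDerivation x y = P.br x y := rfl

theorem PoissonBr.rightDerivation_apply {A : Type*} [CommRing A] (P : PoissonBr A) (x y : A) :
    P.rightDerivation y x = P.br x y :=
  (P.antisymm x y).symm

theorem Derivation.map_matrix_mul_s10 {A n : Type*} [CommRing A] [Fintype n]
    (d : Derivation ℤ A A) (X Y : Matrix n n A) :
    (X * Y).map d = X.map d * Y + X * Y.map d := by
  ext i j
  simp only [Matrix.map_apply, Matrix.mul_apply, Matrix.add_apply, map_sum, Derivation.leibniz,
    smul_eq_mul, ← Finset.sum_add_distrib]
  exact Finset.sum_congr rfl fun k _ => by ring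

theorem Derivation.trace_pow_mul_map_pow {A n : Type*} [CommRing A] [Fintype n] [DecidableEq n]
    (d : Derivation ℤ A A) (X : Matrix n n A) (k m : ℕ) :
    (X ^ k * (X ^ (m + 1)).map d).trace = (m + 1) • (X ^ (k + m) * X.map d).trace := by
  induction m generalizing k with
  | zero => simp
  | succ m ih =>
    rw [pow_succ' X (m + 1), d.map_matrix_mul_s10, Matrix.mul_add, Matrix.trace_add,
      ← Matrix.mul_assoc (X ^ k) X, ← pow_succ, ih, ← Matrix.mul_assoc, Matrix.trace_mul_comm,
      ← Matrix.mul_assoc, ← pow_add, succ_nsmul' _ (m + 1),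
      show m + 1 + k = k + (m + 1) by ring, show k + 1 + m = k + (m + 1) by ring]

theorem Derivation.map_trace_pow {A n : Type*} [CommRing A] [Fintype n] [DecidableEq n]
    (d : Derivation ℤ A A) (X : Matrix n n A) (m : ℕ) :
    d (X ^ (m + 1)).trace = (m + 1) • ∑ i, ∑ j, (X ^ m) j i * d (X i j) := by
  have h := d.trace_pow_mul_map_pow X 0 m
  rw [pow_zero, Matrix.one_mul, Nat.zero_add, Matrix.trace_mul_comm] at h
  simpa [Matrix.trace, Matrix.mul_apply, mul_comm] using h

/-- The bracket of traces of powers is a trace against the matrix of brackets. -/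
theorem PoissonBr.br_trace_pow {A : Type*} [CommRing A] {N : ℕ} (P : PoissonBr A)
    (L Q : Matrix (Fin N) (Fin N) A) (n m : ℕ) :
    P.br (L ^ (n + 1)).trace (Q ^ (m + 1)).trace =
      ((n + 1) * (m + 1)) • (((L ^ n) ⊗ₖ (Q ^ m)) * matBr P L Q).trace := by
  rw [← P.rightDerivation_apply, Derivation.map_trace_pow, mul_smul]
  simp only [P.rightDerivation_apply]
  simp only [← P.leftDerivation_apply, Derivation.map_trace_pow]
  rw [Matrix.trace_mul_comm]
  simp only [Matrix.trace, Matrix.diag, Matrix.mul_apply, Fintype.sum_prod_type, matBr,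
    Matrix.kroneckerMap_apply, P.leftDerivation_apply, mul_smul_comm, ← Finset.smul_sum,
    Finset.mul_sum]
  congr 2
  refine Finset.sum_congr rfl fun i _ => ?_
  rw [Finset.sum_comm]
  refine Finset.sum_congr rfl fun k _ => Finset.sum_congr rfl fun j _ =>
    Finset.sum_congr rfl fun l _ => by ring

theorem trace_mul_mComm_of_commute {A n : Type*} [CommRing A] [Fintype n]
    (X Y Z : Matrix n n A) (h : X * Z = Z * X) : (X * mComm Y Z).trace = 0 := by
  rw [mComm, Matrix.mul_sub, Matrix.trace_sub, ← Matrix.mul_assoc X Z, h, Matrix.mul_assoc,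
    Matrix.trace_mul_comm Z, Matrix.mul_assoc, sub_self]

theorem trace_kronecker_mul_casC {A : Type*} [CommRing A] {N : ℕ}
    (X Y : Matrix (Fin N) (Fin N) A) : ((X ⊗ₖ Y) * casC).trace = (X * Y).trace := by
  simp [Matrix.trace, Matrix.mul_apply, Fintype.sum_prod_type, casC, ite_and]

theorem statement10 {A : Type*} [CommRing A] {N : ℕ} (P : PoissonBr A)
    (L Q : Matrix (Fin N) (Fin N) A)
    (R : Matrix (Fin N × Fin N) (Fin N × Fin N) A)
    (hLL : matBr P L L =
      mComm R (L ⊗ₖ (1 : Matrix (Fin N) (Fin N) A)) -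
        mComm (piSwap R) ((1 : Matrix (Fin N) (Fin N) A) ⊗ₖ L))
    (hLQ : matBr P L Q =
      -mComm (piSwap R) ((1 : Matrix (Fin N) (Fin N) A) ⊗ₖ Q) + casC)
    (hQQ : matBr P Q Q = 0) :
    ∀ n m : ℕ, 1 ≤ n → 1 ≤ m →
      P.br ((L ^ n).trace) ((Q ^ m).trace) =
        (n * m) • ((L ^ (n - 1) * Q ^ (m - 1)).trace) := by
  rintro (_ | n) (_ | m) hn hm
  · omega
  · omega
  · omega
  have hc : ((L ^ n) ⊗ₖ (Q ^ m)) * ((1 : Matrix (Fin N) (Fin N) A) ⊗ₖ Q) =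
      ((1 : Matrix (Fin N) (Fin N) A) ⊗ₖ Q) * ((L ^ n) ⊗ₖ (Q ^ m)) := by
    simp [← Matrix.mul_kronecker_mul, ← pow_succ, ← pow_succ']
  rw [P.br_trace_pow, hLQ, Matrix.mul_add, Matrix.trace_add, Matrix.mul_neg, Matrix.trace_neg,
    trace_mul_mComm_of_commute _ _ _ hc, trace_kronecker_mul_casC]
  simp
end
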